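/- arXiv:2604.04130 — 3 statements merged into one kernel-verified Lean document; each statement's English description precedes it below -/
import Mathlib

section
/- Let f : ℝ^{m×n} → ℝ be locally Lipschitz and μ-weakly convex on ℝ^{m×n}, with subdifferential ∂f(X) := {V − μX : V is a subgradient at X of the convex function f + (μ/2)‖·‖_F²}. Let X ∈ ℝ^{m×n} satisfy XᵀX = Iₙ, let T_X := {H ∈ ℝ^{m×n} : XᵀH + HᵀX = 0} (a linear subspace of ℝ^{m×n}, the tangent space to the Stiefel manifold at X) and let P denote the orthogonal projection onto T_X with respect to the Frobenius inner product. If there exists V ∈ ∂f(X) with ‖P(V)‖_F ≤ ϵ, then there exists Y ∈ S^n such that dist(−2XY, ∂f(X)) ≤ ϵ; since XᵀX = Iₙ, the pair (X, Y) is then an ϵ-KKT point of the problem of minimizing f subject to XᵀX = Iₙ. -/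
open Matrix

noncomputable section

/-- Frobenius inner product `⟨A,B⟩ = tr(AᵀB)`. -/
def frobInner {m n : ℕ} (A B : Matrix (Fin m) (Fin n) ℝ) : ℝ := (Aᵀ * B).trace

/-- Frobenius norm. -/
def frobNorm {m n : ℕ} (A : Matrix (Fin m) (Fin n) ℝ) : ℝ := Real.sqrt (frobInner A A)

/-- `dist(V, A) = inf_{W ∈ A} ‖V − W‖_F`. -/
def frobDist {m n : ℕ} (V : Matrix (Fin m) (Fin n) ℝ) (A : Set (Matrix (Fin m) (Fin n) ℝ)) : ℝ :=
  sInf ((fun W => frobNorm (V - W)) '' A)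

/-- Subdifferential of a `μ`-weakly convex function:
`∂f(X) = {V − μX : V is a subgradient at X of the convex function f + (μ/2)‖·‖_F²}`. -/
def wcSubdiff {m n : ℕ} (μ : ℝ) (f : Matrix (Fin m) (Fin n) ℝ → ℝ)
    (X : Matrix (Fin m) (Fin n) ℝ) : Set (Matrix (Fin m) (Fin n) ℝ) :=
  {W | ∃ V : Matrix (Fin m) (Fin n) ℝ,
    (∀ Z : Matrix (Fin m) (Fin n) ℝ,
      f X + μ / 2 * frobNorm X ^ 2 + frobInner V (Z - X) ≤ f Z + μ / 2 * frobNorm Z ^ 2) ∧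
    W = V - μ • X}

theorem frobNorm_zero {m n : ℕ} : frobNorm (0 : Matrix (Fin m) (Fin n) ℝ) = 0 := by
  simp [frobNorm, frobInner]

theorem frobNorm_neg {m n : ℕ} (A : Matrix (Fin m) (Fin n) ℝ) : frobNorm (-A) = frobNorm A := by
  simp [frobNorm, frobInner]

theorem frobNorm_nonneg {m n : ℕ} (A : Matrix (Fin m) (Fin n) ℝ) : 0 ≤ frobNorm A :=
  Real.sqrt_nonneg _

theorem frobDist_le {m n : ℕ} {A : Set (Matrix (Fin m) (Fin n) ℝ)} {W : Matrix (Fin m) (Fin n) ℝ}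
    (hW : W ∈ A) (V : Matrix (Fin m) (Fin n) ℝ) : frobDist V A ≤ frobNorm (V - W) :=
  csInf_le ⟨0, by rintro _ ⟨U, -, rfl⟩; exact frobNorm_nonneg _⟩ ⟨W, hW, rfl⟩

theorem eq_zero_of_frobInner_self {m n : ℕ} {A : Matrix (Fin m) (Fin n) ℝ}
    (hA : frobInner A A = 0) : A = 0 := by
  rwa [frobInner, ← conjTranspose_eq_transpose_of_trivial,
    trace_conjTranspose_mul_self_eq_zero_iff] at hA

/-- The trace pairing of a symmetric and a skew-symmetric matrix vanishes. -/
theorem trace_mul_eq_zero_of_symm_of_skew {n : ℕ} {S K : Matrix (Fin n) (Fin n) ℝ}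
    (hS : Sᵀ = S) (hK : K + Kᵀ = 0) : (S * K).trace = 0 := by
  have h : (S * K).trace = -(S * K).trace := by
    conv_lhs => rw [← trace_transpose, transpose_mul, hS, eq_neg_of_add_eq_zero_right hK,
      neg_mul, trace_neg, trace_mul_comm]
  linarith

/-- A matrix Frobenius-orthogonal to the tangent space of the Stiefel manifold at `X` has the form
`X * S` with `S` symmetric. -/
theorem exists_isSymm_eq_mul_of_orthogonal_tangent {m n : ℕ} {X N : Matrix (Fin m) (Fin n) ℝ}
    (hX : Xᵀ * X = 1)
    (hN : ∀ H : Matrix (Fin m) (Fin n) ℝ, Xᵀ * H + Hᵀ * X = 0 → frobInner N H = 0) :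
    ∃ S : Matrix (Fin n) (Fin n) ℝ, S.IsSymm ∧ N = X * S := by
  set S : Matrix (Fin n) (Fin n) ℝ := (1 / 2 : ℝ) • (Xᵀ * N + Nᵀ * X) with hSdef
  have hS : Sᵀ = S := by simp [hSdef, transpose_mul, add_comm]
  have hXD : Xᵀ * (N - X * S) = Xᵀ * N - S := by
    rw [Matrix.mul_sub, ← Matrix.mul_assoc, hX, Matrix.one_mul]
  have hskew : Xᵀ * (N - X * S) + (Xᵀ * (N - X * S))ᵀ = 0 := by
    rw [hXD, transpose_sub, hS, transpose_mul, transpose_transpose, hSdef]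
    module
  have htan : Xᵀ * (N - X * S) + (N - X * S)ᵀ * X = 0 := by
    simpa only [transpose_mul, transpose_transpose] using hskew
  have hXS : frobInner (X * S) (N - X * S) = 0 := by
    rw [frobInner, transpose_mul, hS, Matrix.mul_assoc]
    exact trace_mul_eq_zero_of_symm_of_skew hS hskew
  refine ⟨S, hS, sub_eq_zero.mp (eq_zero_of_frobInner_self ?_)⟩
  have hsub : frobInner (N - X * S) (N - X * S)
      = frobInner N (N - X * S) - frobInner (X * S) (N - X * S) := by
    simp only [frobInner, transpose_sub, Matrix.sub_mul, trace_sub]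
  rw [hsub, hN _ htan, hXS, sub_zero]

/-- If `X` is feasible (`XᵀX = Iₙ`) and some `V ∈ ∂f(X)` has Frobenius-orthogonal projection
onto the tangent space `T_X = {H : XᵀH + HᵀX = 0}` of norm at most `ϵ`, then there is a
symmetric `Y` with `dist(−2XY, ∂f(X)) ≤ ϵ`, i.e. `(X,Y)` is an `ϵ`-KKT point. -/
theorem eps_stationary_implies_eps_KKT {m n : ℕ} (hmn : n ≤ m)
    (μ : ℝ) (f : Matrix (Fin m) (Fin n) ℝ → ℝ)
    (hfLip : ∀ X : Matrix (Fin m) (Fin n) ℝ, ∃ K δ : ℝ, 0 < δ ∧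
      ∀ U V : Matrix (Fin m) (Fin n) ℝ, frobNorm (U - X) ≤ δ → frobNorm (V - X) ≤ δ →
        |f U - f V| ≤ K * frobNorm (U - V))
    (hfwc : ConvexOn ℝ (Set.univ : Set (Matrix (Fin m) (Fin n) ℝ))
      (fun X => f X + μ / 2 * frobNorm X ^ 2))
    (X : Matrix (Fin m) (Fin n) ℝ) (hX : Xᵀ * X = 1) (ϵ : ℝ)
    -- there exist `V ∈ ∂f(X)` and `W = P(V)`, the orthogonal projection of `V`
    -- onto the tangent space, with `‖W‖_F ≤ ϵ`:
    (hstat : ∃ V ∈ wcSubdiff μ f X, ∃ W : Matrix (Fin m) (Fin n) ℝ,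
      (Xᵀ * W + Wᵀ * X = 0) ∧
      (∀ H : Matrix (Fin m) (Fin n) ℝ, Xᵀ * H + Hᵀ * X = 0 → frobInner (V - W) H = 0) ∧
      frobNorm W ≤ ϵ) :
    ∃ Y : Matrix (Fin n) (Fin n) ℝ, Y.IsSymm ∧
      frobDist (-((2 : ℝ) • (X * Y))) (wcSubdiff μ f X) ≤ ϵ ∧ frobNorm (Xᵀ * X - 1) ≤ ϵ := by
  obtain ⟨V, hV, W, -, horth, hW⟩ := hstat
  obtain ⟨S, hS, hVW⟩ := exists_isSymm_eq_mul_of_orthogonal_tangent hX horth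
  refine ⟨-(1 / 2 : ℝ) • S, hS.smul _, (frobDist_le hV _).trans ?_, ?_⟩
  · have hXS : -((2 : ℝ) • (X * (-(1 / 2 : ℝ) • S))) - V = -W := by
      rw [Matrix.mul_smul, ← hVW]
      module
    rwa [hXS, frobNorm_neg]
  · rw [hX, sub_self, frobNorm_zero]
    exact (frobNorm_nonneg W).trans hW

end
end

section
/- The function h : ℝ^{m×n} → ℝ defined by h(X) := (1/2)‖XᵀX − Iₙ‖_F² is 2-weakly convex on ℝ^{m×n}; equivalently, the function X ↦ (1/2)‖XᵀX − Iₙ‖_F² + ‖X‖_F² is convex on ℝ^{m×n}. -/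
open Matrix

noncomputable section

theorem frobInner_comm {m n : ℕ} (A B : Matrix (Fin m) (Fin n) ℝ) :
    frobInner A B = frobInner B A := by
  unfold frobInner
  rw [← trace_transpose, transpose_mul, transpose_transpose]

theorem frobInner_add_left {m n : ℕ} (A B C : Matrix (Fin m) (Fin n) ℝ) :
    frobInner (A + B) C = frobInner A C + frobInner B C := by
  simp [frobInner, Matrix.add_mul]

theorem frobInner_smul_left {m n : ℕ} (a : ℝ) (A B : Matrix (Fin m) (Fin n) ℝ) :
    frobInner (a • A) B = a * frobInner A B := by
  simp [frobInner]

theorem frobInner_add_right {m n : ℕ} (A B C : Matrix (Fin m) (Fin n) ℝ) :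
    frobInner A (B + C) = frobInner A B + frobInner A C := by
  simp [frobInner, Matrix.mul_add]

theorem frobInner_smul_right {m n : ℕ} (a : ℝ) (A B : Matrix (Fin m) (Fin n) ℝ) :
    frobInner A (a • B) = a * frobInner A B := by
  simp [frobInner]

theorem frobInner_self_nonneg {m n : ℕ} (A : Matrix (Fin m) (Fin n) ℝ) :
    0 ≤ frobInner A A := by
  simp only [frobInner, trace, diag, Matrix.mul_apply, transpose_apply]
  exact Finset.sum_nonneg fun _ _ => Finset.sum_nonneg fun _ _ => mul_self_nonneg _

theorem frobNorm_sq {m n : ℕ} (A : Matrix (Fin m) (Fin n) ℝ) :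
    frobNorm A ^ 2 = frobInner A A :=
  Real.sq_sqrt (frobInner_self_nonneg A)

/-- Gram matrices have nonnegative Frobenius inner product. -/
theorem frobInner_gram_nonneg {m n : ℕ} (A B : Matrix (Fin m) (Fin n) ℝ) :
    0 ≤ frobInner (Aᵀ * A) (Bᵀ * B) := by
  have h : frobInner (Aᵀ * A) (Bᵀ * B) = frobInner (A * Bᵀ) (A * Bᵀ) := by
    simp only [frobInner, transpose_mul, transpose_transpose]
    rw [← Matrix.mul_assoc, trace_mul_comm]
    simp only [Matrix.mul_assoc]
  rw [h]
  exact frobInner_self_nonneg _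

theorem half_frobNorm_gram_sub_one_sq_add {m n : ℕ} (X : Matrix (Fin m) (Fin n) ℝ) :
    1 / 2 * frobNorm (Xᵀ * X - 1) ^ 2 + frobNorm X ^ 2 =
      1 / 2 * frobInner (Xᵀ * X) (Xᵀ * X) + n / 2 := by
  simp only [frobNorm_sq]
  simp only [frobInner, transpose_sub, transpose_mul, transpose_transpose, transpose_one,
    Matrix.mul_sub, Matrix.sub_mul, Matrix.mul_one, Matrix.one_mul, trace_sub, trace_one,
    Fintype.card_fin]
  ring

theorem gram_convex_combination {m n : ℕ} (X Y : Matrix (Fin m) (Fin n) ℝ) {a b : ℝ}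
    (hab : a + b = 1) :
    a • (Xᵀ * X) + b • (Yᵀ * Y) =
      (a • X + b • Y)ᵀ * (a • X + b • Y) + (a * b) • ((X - Y)ᵀ * (X - Y)) := by
  obtain rfl : b = 1 - a := by linarith
  simp only [transpose_add, transpose_sub, transpose_smul, Matrix.add_mul, Matrix.mul_add,
    Matrix.sub_mul, Matrix.mul_sub, Matrix.smul_mul, Matrix.mul_smul]
  module

/-- The function `X ↦ ‖XᵀX‖_F²` is convex. -/
theorem convexOn_frobInner_gram (m n : ℕ) :
    ConvexOn ℝ (Set.univ : Set (Matrix (Fin m) (Fin n) ℝ))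
      (fun X => frobInner (Xᵀ * X) (Xᵀ * X)) := by
  refine ⟨convex_univ, fun X _ Y _ a b ha hb hab => ?_⟩
  have hG := gram_convex_combination X Y hab
  have hSE := frobInner_gram_nonneg (a • X + b • Y) (X - Y)
  have hEE := frobInner_self_nonneg ((X - Y)ᵀ * (X - Y))
  have hPQ := frobInner_self_nonneg (Xᵀ * X + (-1 : ℝ) • (Yᵀ * Y))
  simp only [smul_eq_mul]
  generalize (a • X + b • Y)ᵀ * (a • X + b • Y) = S at *
  generalize (X - Y)ᵀ * (X - Y) = E at *
  generalize Xᵀ * X = P at *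
  generalize Yᵀ * Y = Q at *
  have h := congrArg (fun M => frobInner M M) hG
  simp only [frobInner_add_left, frobInner_add_right, frobInner_smul_left,
    frobInner_smul_right, frobInner_comm Q P, frobInner_comm E S] at h hPQ
  have hc : 0 ≤ a * b := mul_nonneg ha hb
  have h₁ := mul_nonneg hc hSE
  have h₂ := mul_nonneg (mul_nonneg hc hc) hEE
  have h₃ := mul_nonneg hc hPQ
  obtain rfl : b = 1 - a := by linarith
  linarith

/-- The function `h(X) := (1/2)‖XᵀX − Iₙ‖_F²` is 2-weakly convex on `ℝ^{m×n}`,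
i.e. `X ↦ (1/2)‖XᵀX − Iₙ‖_F² + ‖X‖_F²` is convex on `ℝ^{m×n}`. -/
theorem weakly_convex_penalty {m n : ℕ} (hmn : n ≤ m) :
    ConvexOn ℝ (Set.univ : Set (Matrix (Fin m) (Fin n) ℝ))
      (fun X => 1 / 2 * frobNorm (Xᵀ * X - 1) ^ 2 + frobNorm X ^ 2) := by
  simp only [half_frobNorm_gram_sub_one_sq_add]
  exact ((convexOn_frobInner_gram m n).smul (by norm_num : (0 : ℝ) ≤ 1 / 2)).add_const _

end
end

section
/- Let 𝒳 ⊆ ℝ^{m×n} be a set such that ‖X‖ ≤ R for all X ∈ 𝒳 (spectral norm), and let ℓ : ℝ^{m×n} → ℝ be continuously differentiable with ∇ℓ being L_ℓ-Lipschitz on 𝒳 in Frobenius norm. Then for every Y ∈ S^n and every ρ ≥ 0, the map X ↦ ∇ℓ(X) + 2XY + 2ρ·X(XᵀX − Iₙ) is Lipschitz on 𝒳 in Frobenius norm with Lipschitz constant L_ℓ + 2‖Y‖ + 6ρR² + 2ρ, where ‖Y‖ is the spectral norm. -/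
open Matrix

noncomputable section

/-- Spectral (operator) norm of a matrix. -/
def specNorm {m n : ℕ} (A : Matrix (Fin m) (Fin n) ℝ) : ℝ :=
  ‖LinearMap.toContinuousLinearMap (Matrix.toEuclideanLin A)‖

/-- `gradl` is the (Fréchet) gradient of `ℓ` w.r.t. the Frobenius inner product. -/
def IsGradientOf {m n : ℕ} (gradl : Matrix (Fin m) (Fin n) ℝ → Matrix (Fin m) (Fin n) ℝ)
    (ℓ : Matrix (Fin m) (Fin n) ℝ → ℝ) : Prop :=
  ∀ X : Matrix (Fin m) (Fin n) ℝ, ∀ c : ℝ, 0 < c → ∃ δ : ℝ, 0 < δ ∧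
    ∀ H : Matrix (Fin m) (Fin n) ℝ, frobNorm H ≤ δ →
      |ℓ (X + H) - ℓ X - frobInner (gradl X) H| ≤ c * frobNorm H

theorem frobInner_self_eq_sum {m n : ℕ} (A : Matrix (Fin m) (Fin n) ℝ) :
    frobInner A A = ∑ j, ∑ i, A i j ^ 2 := by
  simp [frobInner, Matrix.trace, Matrix.mul_apply, sq]

theorem frobNorm_sq_eq_sum_col {m n : ℕ} (A : Matrix (Fin m) (Fin n) ℝ) :
    frobNorm A ^ 2 = ∑ j, ‖WithLp.toLp 2 (A.col j)‖ ^ 2 := by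
  have h : frobInner A A = ∑ j, ‖WithLp.toLp 2 (A.col j)‖ ^ 2 := by
    simp [frobInner_self_eq_sum, EuclideanSpace.norm_sq_eq]
  rw [frobNorm, Real.sq_sqrt (h ▸ by positivity), h]

theorem frobNorm_transpose {m n : ℕ} (A : Matrix (Fin m) (Fin n) ℝ) :
    frobNorm Aᵀ = frobNorm A := by
  rw [frobNorm, frobNorm, frobInner_self_eq_sum, frobInner_self_eq_sum, Finset.sum_comm]
  rfl

section

attribute [local instance] Matrix.frobeniusNormedAddCommGroup Matrix.frobeniusNormedSpace

theorem frobNorm_eq_norm {m n : ℕ} (A : Matrix (Fin m) (Fin n) ℝ) : frobNorm A = ‖A‖ := by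
  rw [frobNorm, frobInner_self_eq_sum, Matrix.frobenius_norm_def, Real.sqrt_eq_rpow,
    Finset.sum_comm]
  simp

theorem frobNorm_add_le {m n : ℕ} (A B : Matrix (Fin m) (Fin n) ℝ) :
    frobNorm (A + B) ≤ frobNorm A + frobNorm B := by
  simpa only [frobNorm_eq_norm] using norm_add_le A B

theorem frobNorm_sub_le {m n : ℕ} (A B : Matrix (Fin m) (Fin n) ℝ) :
    frobNorm (A - B) ≤ frobNorm A + frobNorm B := by
  simpa only [frobNorm_eq_norm] using norm_sub_le A B

theorem frobNorm_smul {m n : ℕ} {c : ℝ} (hc : 0 ≤ c) (A : Matrix (Fin m) (Fin n) ℝ) :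
    frobNorm (c • A) = c * frobNorm A := by
  rw [frobNorm_eq_norm, frobNorm_eq_norm, norm_smul, Real.norm_of_nonneg hc]

end

theorem specNorm_nonneg {m n : ℕ} (A : Matrix (Fin m) (Fin n) ℝ) : 0 ≤ specNorm A :=
  norm_nonneg _

theorem specNorm_transpose {m n : ℕ} (A : Matrix (Fin m) (Fin n) ℝ) :
    specNorm Aᵀ = specNorm A := by
  have h := Matrix.l2_opNorm_conjTranspose A
  rwa [Matrix.conjTranspose_eq_transpose_of_trivial] at h

theorem frobNorm_mul_le_specNorm_mul {m n p : ℕ} (A : Matrix (Fin m) (Fin n) ℝ)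
    (B : Matrix (Fin n) (Fin p) ℝ) : frobNorm (A * B) ≤ specNorm A * frobNorm B := by
  refine le_of_sq_le_sq ?_ (mul_nonneg (specNorm_nonneg A) (frobNorm_nonneg B))
  rw [mul_pow, frobNorm_sq_eq_sum_col, frobNorm_sq_eq_sum_col, Finset.mul_sum]
  refine Finset.sum_le_sum fun j _ => ?_
  rw [← mul_pow]
  exact pow_le_pow_left₀ (norm_nonneg _)
    (ContinuousLinearMap.le_opNorm (LinearMap.toContinuousLinearMap (Matrix.toEuclideanLin A))
      (WithLp.toLp 2 (B.col j))) 2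

theorem frobNorm_mul_le_mul_specNorm {m n p : ℕ} (A : Matrix (Fin m) (Fin n) ℝ)
    (B : Matrix (Fin n) (Fin p) ℝ) : frobNorm (A * B) ≤ frobNorm A * specNorm B := by
  rw [← frobNorm_transpose, Matrix.transpose_mul, ← frobNorm_transpose A, ← specNorm_transpose B,
    mul_comm]
  exact frobNorm_mul_le_specNorm_mul _ _

theorem frobNorm_mul_transpose_mul_sub_le {m n : ℕ} {R : ℝ} {X X' : Matrix (Fin m) (Fin n) ℝ}
    (hX : specNorm X ≤ R) (hX' : specNorm X' ≤ R) :
    frobNorm (X * (Xᵀ * X) - X' * (X'ᵀ * X')) ≤ 3 * R ^ 2 * frobNorm (X - X') := by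
  have hR : 0 ≤ R := (specNorm_nonneg X).trans hX
  have left {p q : ℕ} {A : Matrix (Fin p) (Fin q) ℝ} {k : ℕ} (B : Matrix (Fin q) (Fin k) ℝ)
      (hA : specNorm A ≤ R) : frobNorm (A * B) ≤ R * frobNorm B :=
    (frobNorm_mul_le_specNorm_mul A B).trans
      (mul_le_mul_of_nonneg_right hA (frobNorm_nonneg B))
  have right {p q k : ℕ} (A : Matrix (Fin p) (Fin q) ℝ) {B : Matrix (Fin q) (Fin k) ℝ}
      (hB : specNorm B ≤ R) : frobNorm (A * B) ≤ R * frobNorm A :=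
    (frobNorm_mul_le_mul_specNorm A B).trans
      ((mul_le_mul_of_nonneg_left hB (frobNorm_nonneg A)).trans_eq (mul_comm _ _))
  have hsplit : X * (Xᵀ * X) - X' * (X'ᵀ * X') =
      (X - X') * Xᵀ * X + X' * ((X - X')ᵀ * X) + X' * (X'ᵀ * (X - X')) := by
    simp only [Matrix.transpose_sub, Matrix.sub_mul, Matrix.mul_sub, Matrix.mul_assoc]
    abel
  have h₁ := (right ((X - X') * Xᵀ) hX).trans (mul_le_mul_of_nonneg_left
    (right (X - X') ((specNorm_transpose X).trans_le hX)) hR)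
  have h₂ := (left ((X - X')ᵀ * X) hX').trans (mul_le_mul_of_nonneg_left
    (right (X - X')ᵀ hX) hR)
  have h₃ := (left (X'ᵀ * (X - X')) hX').trans (mul_le_mul_of_nonneg_left
    (left (X - X') ((specNorm_transpose X').trans_le hX')) hR)
  rw [frobNorm_transpose] at h₂
  rw [hsplit]
  linarith [frobNorm_add_le ((X - X') * Xᵀ * X + X' * ((X - X')ᵀ * X)) (X' * (X'ᵀ * (X - X'))),
    frobNorm_add_le ((X - X') * Xᵀ * X) (X' * ((X - X')ᵀ * X))]

/-- The gradient of the smooth part of the augmented Lagrangian,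
`X ↦ ∇ℓ(X) + 2XY + 2ρ·X(XᵀX − Iₙ)`, is Lipschitz on `𝒳` with constant
`L_ℓ + 2‖Y‖ + 6ρR² + 2ρ`. -/
theorem augmented_Lagrangian_gradient_Lipschitz {m n : ℕ} (hmn : n ≤ m)
    (𝒳 : Set (Matrix (Fin m) (Fin n) ℝ)) (R : ℝ)
    (h𝒳R : ∀ X ∈ 𝒳, specNorm X ≤ R)
    (ℓ : Matrix (Fin m) (Fin n) ℝ → ℝ)
    (gradl : Matrix (Fin m) (Fin n) ℝ → Matrix (Fin m) (Fin n) ℝ)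
    (Lℓ : ℝ)
    (hgrad : IsGradientOf gradl ℓ) (hgradcont : Continuous gradl)
    (hgradLip : ∀ X ∈ 𝒳, ∀ X' ∈ 𝒳, frobNorm (gradl X - gradl X') ≤ Lℓ * frobNorm (X - X'))
    (Y : Matrix (Fin n) (Fin n) ℝ) (hY : Y.IsSymm) (ρ : ℝ) (hρ : 0 ≤ ρ) :
    ∀ X ∈ 𝒳, ∀ X' ∈ 𝒳,
      frobNorm ((gradl X + (2 : ℝ) • (X * Y) + (2 * ρ) • (X * (Xᵀ * X - 1)))
          - (gradl X' + (2 : ℝ) • (X' * Y) + (2 * ρ) • (X' * (X'ᵀ * X' - 1))))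
        ≤ (Lℓ + 2 * specNorm Y + 6 * ρ * R ^ 2 + 2 * ρ) * frobNorm (X - X') := by
  intro X hX X' hX'
  have hsplit : (gradl X + (2 : ℝ) • (X * Y) + (2 * ρ) • (X * (Xᵀ * X - 1)))
      - (gradl X' + (2 : ℝ) • (X' * Y) + (2 * ρ) • (X' * (X'ᵀ * X' - 1))) =
      (gradl X - gradl X') + (2 : ℝ) • ((X - X') * Y)
        + (2 * ρ) • ((X * (Xᵀ * X) - X' * (X'ᵀ * X')) - (X - X')) := by
    simp only [Matrix.sub_mul, Matrix.mul_sub, Matrix.mul_one, smul_sub]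
    abel
  rw [hsplit]
  refine (frobNorm_add_le _ _).trans ((add_le_add_left (frobNorm_add_le _ _) _).trans ?_)
  rw [frobNorm_smul zero_le_two, frobNorm_smul (by positivity : 0 ≤ 2 * ρ)]
  have hl := hgradLip X hX X' hX'
  have hy := frobNorm_mul_le_mul_specNorm (X - X') Y
  have hc := mul_le_mul_of_nonneg_left ((frobNorm_sub_le _ (X - X')).trans (add_le_add_left
    (frobNorm_mul_transpose_mul_sub_le (h𝒳R X hX) (h𝒳R X' hX')) _))
    (by positivity : 0 ≤ 2 * ρ)
  linarith

end
end
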